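/- With the notation of the canonical system: the map κ̃ ↦ h(κ̃) (the unique solution in κ of g(κ, κ̃)=1) is strictly decreasing, and the map κ̃ ↦ κ̃·h(κ̃) is strictly increasing on (0,∞). Consequently the system β = (1/t)Tr[D(σ²(I_r + Dβ̃) + B(I_t + D̃β)⁻¹Bᴴ)⁻¹], β̃ = (1/t)Tr[D̃(σ²(I_t + D̃β) + Bᴴ(I_r + Dβ̃)⁻¹B)⁻¹] admits a unique pair (β, β̃) of strictly positive solutions. -/

import Mathlib

open Matrix Set

namespace CanonSys

open scoped ComplexOrder

set_option linter.unusedSectionVars false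

variable {m n : Type*} [Fintype m] [DecidableEq m] [Fintype n] [DecidableEq n]

/-- The diagonal-plus-Gram matrix. -/
noncomputable def P (B : Matrix m n ℂ) (u : m → ℝ) (v : n → ℝ) : Matrix m m ℂ :=
  diagonal (fun i => (u i : ℂ)) + B * diagonal (fun j => (v j : ℂ)) * Bᴴ

lemma diag_psd (u : m → ℝ) (hu : ∀ i, 0 ≤ u i) :
    (diagonal (fun i => (u i : ℂ))).PosSemidef :=
  PosSemidef.diagonal (fun i => by simpa using hu i)

lemma P_posDef (B : Matrix m n ℂ) (u : m → ℝ) (v : n → ℝ) (hu : ∀ i, 0 < u i)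
    (hv : ∀ j, 0 ≤ v j) : (P B u v).PosDef := by
  refine PosDef.add_posSemidef (PosDef.diagonal (fun i => by simpa using hu i)) ?_
  exact (diag_psd v hv).mul_mul_conjTranspose_same B

lemma P_sub (B : Matrix m n ℂ) (u u' : m → ℝ) (v v' : n → ℝ) :
    P B u' v' - P B u v = P B (fun i => u' i - u i) (fun j => v' j - v j) := by
  have h1 : diagonal (fun j => ((v' j - v j : ℝ) : ℂ))
      = diagonal (fun j => (v' j : ℂ)) - diagonal (fun j => (v j : ℂ)) := by
    rw [diagonal_sub]; simp
  have h2 : diagonal (fun j => ((u' j - u j : ℝ) : ℂ))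
      = diagonal (fun j => (u' j : ℂ)) - diagonal (fun j => (u j : ℂ)) := by
    rw [diagonal_sub]; simp
  unfold P
  rw [h1, h2, Matrix.mul_sub, Matrix.sub_mul]
  abel

/-- Second-order expansion of the inverse difference. -/
lemma inv_sub_inv_eq (A C : Matrix m m ℂ) (hA : A.PosDef) (hC : C.PosDef) :
    A⁻¹ - C⁻¹ = C⁻¹ * (C - A) * C⁻¹ + (C⁻¹ * (C - A)) * A⁻¹ * (C⁻¹ * (C - A))ᴴ := by
  have hA' : IsUnit A.det := (isUnit_iff_isUnit_det A).1 hA.isUnit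
  have hC' : IsUnit C.det := (isUnit_iff_isUnit_det C).1 hC.isUnit
  have e1 : (C⁻¹ * (C - A))ᴴ = (C - A) * C⁻¹ := by
    rw [conjTranspose_mul, conjTranspose_sub, hA.isHermitian.eq, hC.isHermitian.eq,
      hC.inv.isHermitian.eq]
  have e2 : A⁻¹ * ((C - A) * C⁻¹) = A⁻¹ - C⁻¹ := by
    rw [Matrix.sub_mul, mul_nonsing_inv _ hC', Matrix.mul_sub, ← Matrix.mul_assoc,
      nonsing_inv_mul _ hA']
    simp
  have e3 : C⁻¹ * (C - A) * A⁻¹ = A⁻¹ - C⁻¹ := by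
    rw [Matrix.mul_sub, nonsing_inv_mul _ hC', Matrix.sub_mul, Matrix.mul_assoc,
      mul_nonsing_inv _ hA']
    simp
  rw [e1, Matrix.mul_assoc (C⁻¹ * (C - A)), e2, Matrix.mul_sub (C⁻¹ * (C - A)), e3]
  abel

lemma inv_diag (B : Matrix m n ℂ) (u u' : m → ℝ) (v v' : n → ℝ) (hu : ∀ i, 0 < u i)
    (hv : ∀ j, 0 ≤ v j) (huu : ∀ i, u i ≤ u' i) (hvv : ∀ j, v j ≤ v' j) (i : m) :
    ((P B u' v')⁻¹ i i).re ≤ ((P B u v)⁻¹ i i).re ∧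
    (u i < u' i → ((P B u' v')⁻¹ i i).re < ((P B u v)⁻¹ i i).re) := by
  have hA := P_posDef B u v hu hv
  have hC := P_posDef B u' v' (fun i => (hu i).trans_le (huu i)) (fun i => (hv i).trans (hvv i))
  have key := inv_sub_inv_eq _ _ hA hC
  rw [P_sub] at key
  set W := (P B u' v')⁻¹ with hW
  have hWh : Wᴴ = W := hC.inv.isHermitian.eq
  have hWp : 0 < (W i i).re := by
    have := hC.inv.diag_pos (i := i)
    exact (Complex.pos_iff.1 this).1
  have t2 := (hA.inv.posSemidef.mul_mul_conjTranspose_same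
    (W * P B (fun i => u' i - u i) (fun j => v' j - v j))).diag_nonneg (i := i)
  have t3 : 0 ≤ (W * (B * diagonal (fun j => ((v' j - v j : ℝ) : ℂ)) * Bᴴ) * W) i i := by
    have := (((diag_psd (fun j => v' j - v j) (fun j => sub_nonneg.2 (hvv j))).mul_mul_conjTranspose_same
      B).mul_mul_conjTranspose_same W).diag_nonneg (i := i)
    rwa [hWh] at this
  have t4 : ((W * diagonal (fun j => ((u' j - u j : ℝ) : ℂ)) * W) i i).re
      = ∑ k, (u' k - u k) * Complex.normSq (W i k) := by
    rw [Matrix.mul_apply, Complex.re_sum]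
    refine Finset.sum_congr rfl fun k _ => ?_
    have : W k i = star (W i k) := by
      conv_lhs => rw [← hWh]
      rfl
    rw [mul_diagonal, this, mul_right_comm, ← starRingEnd_apply, Complex.mul_conj,
      ← Complex.ofReal_mul, Complex.ofReal_re, mul_comm]
  have t5 : (u' i - u i) * Complex.normSq (W i i) ≤ ∑ k, (u' k - u k) * Complex.normSq (W i k) :=
    Finset.single_le_sum (f := fun k => (u' k - u k) * Complex.normSq (W i k))
      (fun k _ => mul_nonneg (sub_nonneg.2 (huu k)) (Complex.normSq_nonneg _)) (Finset.mem_univ i)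
  have key2 := congrArg Complex.re (congrFun (congrFun key i) i)
  have e : W * P B (fun i => u' i - u i) (fun j => v' j - v j) * W =
      W * diagonal (fun j => ((u' j - u j : ℝ) : ℂ)) * W +
      W * (B * diagonal (fun j => ((v' j - v j : ℝ) : ℂ)) * Bᴴ) * W := by
    unfold P
    rw [Matrix.mul_add, Matrix.add_mul]
  rw [Matrix.sub_apply, Complex.sub_re, Matrix.add_apply, Complex.add_re, e, Matrix.add_apply,
    Complex.add_re, t4] at key2
  have t2' := (Complex.nonneg_iff.1 t2).1
  have t3' := (Complex.nonneg_iff.1 t3).1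
  have t6 : 0 < Complex.normSq (W i i) := by
    apply Complex.normSq_pos.2
    intro h0
    rw [h0] at hWp
    simp at hWp
  constructor
  · have := mul_nonneg (sub_nonneg.2 (huu i)) t6.le
    linarith
  · intro hlt
    have := mul_pos (sub_pos.2 hlt) t6
    linarith

/-- The trace functional. -/
noncomputable def G (d : m → ℝ) (B : Matrix m n ℂ) (u : m → ℝ) (v : n → ℝ) : ℝ :=
  ((diagonal (fun i => (d i : ℂ)) * (P B u v)⁻¹).trace).re

lemma G_eq (d : m → ℝ) (B : Matrix m n ℂ) (u : m → ℝ) (v : n → ℝ) :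
    G d B u v = ∑ i, d i * ((P B u v)⁻¹ i i).re := by
  unfold G
  rw [Matrix.trace, Complex.re_sum]
  refine Finset.sum_congr rfl fun k _ => ?_
  rw [diag_apply, diagonal_mul, Complex.re_ofReal_mul]

lemma exists_pos (d : m → ℝ) (hs : 0 < ∑ i, d i) : ∃ i, 0 < d i := by
  by_contra! hcon
  exact absurd (Finset.sum_nonpos (fun i _ => hcon i)) (not_le.2 hs)

lemma G_pos (d : m → ℝ) (hd : ∀ i, 0 ≤ d i) (hs : 0 < ∑ i, d i) (B : Matrix m n ℂ)
    (u : m → ℝ) (v : n → ℝ) (hu : ∀ i, 0 < u i) (hv : ∀ j, 0 ≤ v j) : 0 < G d B u v := by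
  obtain ⟨i, hi⟩ := exists_pos d hs
  have hp : ∀ i, 0 < ((P B u v)⁻¹ i i).re := fun i =>
    (Complex.pos_iff.1 ((P_posDef B u v hu hv).inv.diag_pos (i := i))).1
  rw [G_eq]
  exact Finset.sum_pos' (fun i _ => mul_nonneg (hd i) (hp i).le)
    ⟨i, Finset.mem_univ i, mul_pos hi (hp i)⟩

lemma G_le (d : m → ℝ) (hd : ∀ i, 0 ≤ d i) (B : Matrix m n ℂ) (u u' : m → ℝ) (v v' : n → ℝ)
    (hu : ∀ i, 0 < u i) (hv : ∀ j, 0 ≤ v j) (huu : ∀ i, u i ≤ u' i) (hvv : ∀ j, v j ≤ v' j) :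
    G d B u' v' ≤ G d B u v := by
  rw [G_eq, G_eq]
  exact Finset.sum_le_sum fun i _ =>
    mul_le_mul_of_nonneg_left (inv_diag B u u' v v' hu hv huu hvv i).1 (hd i)

lemma G_lt (d : m → ℝ) (hd : ∀ i, 0 ≤ d i) (hs : 0 < ∑ i, d i) (B : Matrix m n ℂ)
    (u u' : m → ℝ) (v v' : n → ℝ)
    (hu : ∀ i, 0 < u i) (hv : ∀ j, 0 ≤ v j) (huu : ∀ i, u i ≤ u' i) (hvv : ∀ j, v j ≤ v' j)
    (hlt : ∀ i, 0 < d i → u i < u' i) :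
    G d B u' v' < G d B u v := by
  obtain ⟨i, hi⟩ := exists_pos d hs
  rw [G_eq, G_eq]
  exact Finset.sum_lt_sum (fun i _ =>
    mul_le_mul_of_nonneg_left (inv_diag B u u' v v' hu hv huu hvv i).1 (hd i))
    ⟨i, Finset.mem_univ i, mul_lt_mul_of_pos_left
      ((inv_diag B u u' v v' hu hv huu hvv i).2 (hlt i hi)) hi⟩

lemma G_smul (d : m → ℝ) (B : Matrix m n ℂ) (u : m → ℝ) (v : n → ℝ) (x : ℝ) (hx : 0 < x)
    (hu : ∀ i, 0 < u i) (hv : ∀ j, 0 ≤ v j) :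
    G d B u v = x * G d B (fun i => x * u i) (fun j => x * v j) := by
  have e : P B (fun i => x * u i) (fun j => x * v j) = (x : ℂ) • P B u v := by
    have h1 : diagonal (fun j => ((x * v j : ℝ) : ℂ)) = (x : ℂ) • diagonal (fun j => (v j : ℂ)) := by
      rw [← diagonal_smul]; congr 1; ext j; simp
    have h2 : diagonal (fun j => ((x * u j : ℝ) : ℂ)) = (x : ℂ) • diagonal (fun j => (u j : ℂ)) := by
      rw [← diagonal_smul]; congr 1; ext j; simp
    unfold P
    rw [h1, h2, smul_add, Matrix.mul_smul, Matrix.smul_mul]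
  have hx' : (x : ℂ) ≠ 0 := by exact_mod_cast hx.ne'
  have hdet : IsUnit (P B u v).det := (isUnit_iff_isUnit_det _).1 (P_posDef B u v hu hv).isUnit
  have e2 : (P B (fun i => x * u i) (fun j => x * v j))⁻¹ = ((x⁻¹ : ℝ) : ℂ) • (P B u v)⁻¹ := by
    apply inv_eq_right_inv
    rw [e, Matrix.smul_mul, Matrix.mul_smul, mul_nonsing_inv _ hdet, smul_smul]
    push_cast
    rw [mul_inv_cancel₀ hx', one_smul]
  rw [G_eq, G_eq, e2, Finset.mul_sum]
  refine Finset.sum_congr rfl fun i _ => ?_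
  rw [Matrix.smul_apply, smul_eq_mul, Complex.re_ofReal_mul]
  field_simp

/-- The right-hand side of the canonical equation. -/
noncomputable def T (d : m → ℝ) (e : n → ℝ) (B : Matrix m n ℂ) (s x y : ℝ) : ℝ :=
  G d B (fun i => s * (1 + y * d i)) (fun j => (1 + x * e j)⁻¹)

lemma T_eq (d : m → ℝ) (e : n → ℝ) (he : ∀ j, 0 ≤ e j) (B : Matrix m n ℂ) (s x y : ℝ)
    (hx : 0 ≤ x) :
    ((diagonal (fun i => (d i : ℂ)) *
          (s • (1 + y • diagonal (fun i => (d i : ℂ))) +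
            B * (1 + x • diagonal (fun j => (e j : ℂ)))⁻¹ * Bᴴ)⁻¹).trace).re
      = T d e B s x y := by
  have h1 : s • (1 + y • diagonal (fun i => (d i : ℂ)))
      = diagonal (fun i => ((s * (1 + y * d i) : ℝ) : ℂ)) := by
    rw [← diagonal_one, ← diagonal_smul, diagonal_add, ← diagonal_smul]
    congr 1; ext i; simp; ring
  have h2 : (1 + x • diagonal (fun j => (e j : ℂ)))⁻¹
      = diagonal (fun j => (((1 + x * e j)⁻¹ : ℝ) : ℂ)) := by
    apply inv_eq_right_inv
    rw [← diagonal_one, ← diagonal_smul, diagonal_add, diagonal_mul_diagonal]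
    congr 1; ext j
    have : (1 + x * e j) ≠ 0 := by have := mul_nonneg hx (he j); positivity
    have h3 : (1 + (x:ℂ) * e j) ≠ 0 := by exact_mod_cast this
    simp [h3]
  rw [h1, h2]
  rfl

/-- Scaled version. -/
noncomputable def S (d : m → ℝ) (e : n → ℝ) (B : Matrix m n ℂ) (s x c : ℝ) : ℝ :=
  G d B (fun i => s * (x + c * d i)) (fun j => x * (1 + x * e j)⁻¹)

lemma T_S (d : m → ℝ) (e : n → ℝ) (hd : ∀ i, 0 ≤ d i) (he : ∀ j, 0 ≤ e j)
    (B : Matrix m n ℂ) (s : ℝ) (hσ : 0 < s) (x y : ℝ) (hx : 0 < x) (hy : 0 ≤ y) :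
    T d e B s x y = x * S d e B s x (y * x) := by
  unfold T S
  rw [G_smul d B _ _ x hx]
  · congr 2
    ext i
    ring
  · intro i
    have := mul_nonneg hy (hd i)
    positivity
  · intro j
    have := he j
    positivity

lemma frac_mono (a x x' : ℝ) (ha : 0 ≤ a) (hx : 0 < x) (h : x ≤ x') :
    x * (1 + x * a)⁻¹ ≤ x' * (1 + x' * a)⁻¹ := by
  have hx' := hx.trans_le h
  rw [← div_eq_mul_inv, ← div_eq_mul_inv, div_le_div_iff₀ (by positivity) (by positivity)]
  nlinarith

lemma S_lt (d : m → ℝ) (e : n → ℝ) (hd : ∀ i, 0 ≤ d i) (he : ∀ j, 0 ≤ e j)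
    (hs : 0 < ∑ i, d i)
    (B : Matrix m n ℂ) (s : ℝ) (hσ : 0 < s) (x x' c c' : ℝ) (hx : 0 < x) (hc : 0 ≤ c) (hxx : x ≤ x') (hcc : c ≤ c')
    (hlt : x < x' ∨ c < c') : S d e B s x' c' < S d e B s x c := by
  refine G_lt d hd hs B _ _ _ _ ?_ ?_ ?_ ?_ ?_
  · intro i
    have := hd i
    positivity
  · intro j
    have := he j
    positivity
  · intro i
    have := hd i
    gcongr
  · intro j
    exact frac_mono _ _ _ (he j) hx hxx
  · intro i hi
    apply mul_lt_mul_of_pos_left _ hσ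
    rcases hlt with h | h
    · have := mul_le_mul_of_nonneg_right hcc hi.le
      linarith
    · have := mul_lt_mul_of_pos_right h hi
      linarith

lemma T_le (d : m → ℝ) (e : n → ℝ) (hd : ∀ i, 0 ≤ d i) (he : ∀ j, 0 ≤ e j)
    (B : Matrix m n ℂ) (s : ℝ) (hσ : 0 < s) (x x' y y' : ℝ) (hx : 0 ≤ x) (hy : 0 ≤ y) (hxx : x ≤ x') (hyy : y ≤ y') :
    T d e B s x y' ≤ T d e B s x' y := by
  have hx' := hx.trans hxx
  refine G_le d hd B _ _ _ _ ?_ ?_ ?_ ?_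
  · intro i
    have := hd i
    positivity
  · intro j
    have := he j
    positivity
  · intro i
    have := hd i
    gcongr
  · intro j
    have := he j
    gcongr

lemma T_pos (d : m → ℝ) (e : n → ℝ) (hd : ∀ i, 0 ≤ d i) (he : ∀ j, 0 ≤ e j)
    (hs : 0 < ∑ i, d i)
    (B : Matrix m n ℂ) (s : ℝ) (hσ : 0 < s) (x y : ℝ) (hx : 0 ≤ x) (hy : 0 ≤ y) : 0 < T d e B s x y := by
  refine G_pos d hd hs B _ _ ?_ ?_
  · intro i
    have := hd i
    positivity
  · intro j
    have := he j
    positivity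

lemma T_bdd (d : m → ℝ) (e : n → ℝ) (hd : ∀ i, 0 ≤ d i) (he : ∀ j, 0 ≤ e j)
    (B : Matrix m n ℂ) (s : ℝ) (hσ : 0 < s) : ∃ K, ∀ x y : ℝ, 0 ≤ x → 0 ≤ y → T d e B s x y ≤ K := by
  refine ⟨G d B (fun _ => s) (fun _ => 0), fun x y hx hy => ?_⟩
  refine G_le d hd B _ _ _ _ (fun _ => hσ) (fun _ => le_rfl) ?_ ?_
  · intro i
    have := mul_nonneg hy (hd i)
    nlinarith
  · intro j
    have := he j
    positivity

/-- Elementary Knaster-Tarski on a real interval. -/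
lemma exists_fixed (F : ℝ → ℝ) (a b : ℝ) (ha : 0 < a)
    (hF : ∀ x y, 0 < x → x ≤ y → F x ≤ F y) (hFa : ∀ x, 0 < x → F x ≤ b → a ≤ F x)
    (hFb : ∀ x, 0 < x → F x ≤ b) : ∃ z, 0 < z ∧ F z = z := by
  let U : Set ℝ := {y | a ≤ y ∧ y ≤ b ∧ y ≤ F y}
  have haU : a ∈ U := ⟨le_rfl, (hFa a ha (hFb a ha)).trans (hFb a ha), hFa a ha (hFb a ha)⟩
  have hbd : BddAbove U := ⟨b, fun y hy => hy.2.1⟩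
  have hz : a ≤ sSup U := le_csSup hbd haU
  have hz0 : 0 < sSup U := ha.trans_le hz
  have h1 : sSup U ≤ F (sSup U) := csSup_le ⟨a, haU⟩ fun y hy =>
    hy.2.2.trans (hF _ _ (ha.trans_le hy.1) (le_csSup hbd hy))
  refine ⟨sSup U, hz0, le_antisymm (le_csSup hbd ⟨?_, ?_, ?_⟩) h1⟩
  · exact hFa _ hz0 (hFb _ hz0)
  · exact hFb _ hz0
  · exact hF _ _ hz0 h1

end CanonSys



theorem canonical_system_unique_solution
    {r t : ℕ} (d : Fin r → ℝ) (dt : Fin t → ℝ)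
    (hd : ∀ i, 0 ≤ d i) (hdt : ∀ j, 0 ≤ dt j)
    (hdsum : 0 < ∑ i, d i) (hdtsum : 0 < ∑ j, dt j)
    (B : Matrix (Fin r) (Fin t) ℂ) (σ2 : ℝ) (hσ : 0 < σ2)
    (h : ℝ → ℝ)
    (hh : ∀ kt : ℝ, 0 < kt → 0 < h kt ∧
      (h kt)⁻¹ * (1 / (t : ℝ)) *
        ((Matrix.diagonal (fun i => (d i : ℂ)) *
          (σ2 • (1 + kt • Matrix.diagonal (fun i => (d i : ℂ))) +
            B * (1 + h kt • Matrix.diagonal (fun j => (dt j : ℂ)))⁻¹ * Bᴴ)⁻¹).trace).re = 1) :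
    StrictAntiOn h (Set.Ioi 0) ∧
    StrictMonoOn (fun kt => kt * h kt) (Set.Ioi 0) ∧
    ∃! p : ℝ × ℝ, 0 < p.1 ∧ 0 < p.2 ∧
      p.1 = (1 / (t : ℝ)) *
        ((Matrix.diagonal (fun i => (d i : ℂ)) *
          (σ2 • (1 + p.2 • Matrix.diagonal (fun i => (d i : ℂ))) +
            B * (1 + p.1 • Matrix.diagonal (fun j => (dt j : ℂ)))⁻¹ * Bᴴ)⁻¹).trace).re ∧
      p.2 = (1 / (t : ℝ)) *
        ((Matrix.diagonal (fun j => (dt j : ℂ)) *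
          (σ2 • (1 + p.1 • Matrix.diagonal (fun j => (dt j : ℂ))) +
            Bᴴ * (1 + p.2 • Matrix.diagonal (fun i => (d i : ℂ)))⁻¹ * B)⁻¹).trace).re := by

  have ht : 0 < (1 / (t : ℝ)) := by
    have : t ≠ 0 := by
      rintro rfl
      simp at hdtsum
    positivity
  set a := 1 / (t : ℝ) with ha
  -- rewrite everything with `T`
  have hh1 : ∀ y, 0 < y → 0 < h y := fun y hy => (hh y hy).1
  have hh2 : ∀ y, 0 < y → a * CanonSys.S d dt B σ2 (h y) (y * h y) = 1 := by
    intro y hy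
    have h2 := (hh y hy).2
    have h1 := hh1 y hy
    rw [CanonSys.T_eq d dt hdt B σ2 (h y) y h1.le,
      CanonSys.T_S d dt hd hdt B σ2 hσ (h y) y h1 hy.le] at h2
    rw [← h2]
    field_simp
  have hT : ∀ y, 0 < y → h y = a * CanonSys.T d dt B σ2 (h y) y := by
    intro y hy
    rw [CanonSys.T_S d dt hd hdt B σ2 hσ (h y) y (hh1 y hy) hy.le]
    have := hh2 y hy
    linear_combination (- h y) * this
  have hanti : StrictAntiOn h (Set.Ioi 0) := by
    intro y hy y' hy' hlt
    simp only [Set.mem_Ioi] at hy hy'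
    by_contra! hcon
    have h1 := hh1 y hy
    have := CanonSys.S_lt d dt hd hdt hdsum B σ2 hσ (h y) (h y') (y * h y) (y' * h y')
      h1 (by positivity) hcon (by gcongr) (Or.inr (by nlinarith))
    have := mul_lt_mul_of_pos_left this ht
    rw [hh2 y hy, hh2 y' hy'] at this
    exact lt_irrefl _ this
  have hmono : StrictMonoOn (fun kt => kt * h kt) (Set.Ioi 0) := by
    intro y hy y' hy' hlt
    have hl := hanti hy hy' hlt
    simp only [Set.mem_Ioi] at hy hy'
    by_contra! hcon
    have h1 := hh1 y' hy'
    have := CanonSys.S_lt d dt hd hdt hdsum B σ2 hσ (h y') (h y) (y' * h y') (y * h y)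
      h1 (by positivity) hl.le hcon (Or.inl hl)
    have := mul_lt_mul_of_pos_left this ht
    rw [hh2 y hy, hh2 y' hy'] at this
    exact lt_irrefl _ this
  refine ⟨hanti, hmono, ?_⟩
  have hiff : ∀ x y, 0 < x → 0 < y → x = a * CanonSys.T d dt B σ2 x y → x = h y := by
    intro x y hx hy hxy
    rw [CanonSys.T_S d dt hd hdt B σ2 hσ x y hx hy.le] at hxy
    have e1 : a * CanonSys.S d dt B σ2 x (y * x) = 1 :=
      mul_left_cancel₀ hx.ne' (by linear_combination -hxy)
    have h1 := hh1 y hy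
    have h2 := hh2 y hy
    rcases lt_trichotomy x (h y) with hlt | heq | hlt
    · have := CanonSys.S_lt d dt hd hdt hdsum B σ2 hσ x (h y) (y * x) (y * h y)
        hx (by positivity) hlt.le (by gcongr) (Or.inl hlt)
      have := mul_lt_mul_of_pos_left this ht
      rw [e1, h2] at this
      exact absurd this (lt_irrefl _)
    · exact heq
    · have := CanonSys.S_lt d dt hd hdt hdsum B σ2 hσ (h y) x (y * h y) (y * x)
        h1 (by positivity) hlt.le (by gcongr) (Or.inl hlt)
      have := mul_lt_mul_of_pos_left this ht
      rw [e1, h2] at this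
      exact absurd this (lt_irrefl _)
  -- the second equation
  have hTB : ∀ x y : ℝ, 0 ≤ y →
      ((Matrix.diagonal (fun j => (dt j : ℂ)) *
          (σ2 • (1 + x • Matrix.diagonal (fun j => (dt j : ℂ))) +
            Bᴴ * (1 + y • Matrix.diagonal (fun i => (d i : ℂ)))⁻¹ * B)⁻¹).trace).re
        = CanonSys.T dt d Bᴴ σ2 y x := by
    intro x y hy
    have := CanonSys.T_eq dt d hd Bᴴ σ2 y x hy
    rwa [conjTranspose_conjTranspose] at this
  obtain ⟨K, hK⟩ := CanonSys.T_bdd d dt hd hdt B σ2 hσ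
  obtain ⟨K', hK'⟩ := CanonSys.T_bdd dt d hdt hd Bᴴ σ2 hσ
  have hK0 : 0 < K := (CanonSys.T_pos d dt hd hdt hdsum B σ2 hσ 0 0 le_rfl le_rfl).trans_le
    (hK 0 0 le_rfl le_rfl)
  have hhK : ∀ y, 0 < y → h y ≤ a * K := by
    intro y hy
    rw [hT y hy]
    exact mul_le_mul_of_nonneg_left (hK _ _ (hh1 y hy).le hy.le) ht.le
  obtain ⟨z, hz, hFz⟩ := CanonSys.exists_fixed (fun y => a * CanonSys.T dt d Bᴴ σ2 y (h y))
    (a * CanonSys.T dt d Bᴴ σ2 0 (a * K)) (a * K')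
    (mul_pos ht (CanonSys.T_pos dt d hdt hd hdtsum Bᴴ σ2 hσ 0 _ le_rfl (by positivity)))
    (by
      intro x y hx hxy
      have hy := hx.trans_le hxy
      refine mul_le_mul_of_nonneg_left ?_ ht.le
      exact CanonSys.T_le dt d hdt hd Bᴴ σ2 hσ _ _ _ _ hx.le (hh1 y hy).le hxy
        (hanti.antitoneOn hx hy hxy))
    (by
      intro x hx _
      refine mul_le_mul_of_nonneg_left ?_ ht.le
      exact CanonSys.T_le dt d hdt hd Bᴴ σ2 hσ _ _ _ _ le_rfl (hh1 x hx).le hx.le (hhK x hx))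
    (by
      intro x hx
      exact mul_le_mul_of_nonneg_left (hK' _ _ hx.le (hh1 x hx).le) ht.le)
  -- uniqueness for the reduced equation
  have huniq : ∀ y y', 0 < y → y < y' → y = a * CanonSys.T dt d Bᴴ σ2 y (h y) →
      y' = a * CanonSys.T dt d Bᴴ σ2 y' (h y') → False := by
    intro y y' hy hlt e1 e2
    have hy' := hy.trans hlt
    have h1 := hh1 y hy
    have h1' := hh1 y' hy'
    rw [CanonSys.T_S dt d hdt hd Bᴴ σ2 hσ _ _ hy h1.le] at e1
    rw [CanonSys.T_S dt d hdt hd Bᴴ σ2 hσ _ _ hy' h1'.le] at e2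
    have f1 : a * CanonSys.S dt d Bᴴ σ2 y (h y * y) = 1 :=
      mul_left_cancel₀ hy.ne' (by linear_combination -e1)
    have f2 : a * CanonSys.S dt d Bᴴ σ2 y' (h y' * y') = 1 :=
      mul_left_cancel₀ hy'.ne' (by linear_combination -e2)
    have hc : y * h y < y' * h y' := hmono hy hy' hlt
    have := CanonSys.S_lt dt d hdt hd hdtsum Bᴴ σ2 hσ y y' (h y * y) (h y' * y')
      hy (by positivity) hlt.le (by linarith) (Or.inl hlt)
    have := mul_lt_mul_of_pos_left this ht
    rw [f1, f2] at this
    exact lt_irrefl _ this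
  refine ⟨(h z, z), ⟨hh1 z hz, hz, ?_, ?_⟩, ?_⟩
  · simp only
    rw [CanonSys.T_eq d dt hdt B σ2 (h z) z (hh1 z hz).le]
    exact hT z hz
  · simp only
    rw [hTB _ _ hz.le]
    exact hFz.symm
  · rintro ⟨x, y⟩ ⟨hx, hy, e1, e2⟩
    simp only at hx hy e1 e2
    rw [CanonSys.T_eq d dt hdt B σ2 x y hx.le] at e1
    rw [hTB _ _ hy.le] at e2
    have hxy := hiff x y hx hy e1
    rw [hxy] at e2
    have hyz : y = z := by
      rcases lt_trichotomy y z with hlt | heq | hlt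
      · exact (huniq y z hy hlt e2 hFz.symm).elim
      · exact heq
      · exact (huniq z y hz hlt hFz.symm e2).elim
    rw [hxy, hyz]
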